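/- Let n ≥ 1 and let K be a 1-symmetric convex body in ℝ^n. Then the supremum over all a ∈ ℝ^n \ {0} of (‖a‖₁/‖a‖₂)·vol_{n-1}(K ∩ a^⊥) is attained at the diagonal vector (1,…,1), and equals √n · vol_{n-1}(K ∩ (1,…,1)^⊥). -/

import Mathlib

open MeasureTheory Finset

/-- The (n-1)-dimensional Hausdorff measure of the central hyperplane section
`K ∩ a^⊥`. -/
noncomputable def sectVol (n : ℕ) (K : Set (EuclideanSpace ℝ (Fin n)))
    (a : EuclideanSpace ℝ (Fin n)) : ℝ :=
  (Measure.hausdorffMeasure ((n : ℝ) - 1)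
    (K ∩ {x : EuclideanSpace ℝ (Fin n) | inner ℝ x a = (0 : ℝ)})).toReal

/-- `V_K(a) = (‖a‖₁ / ‖a‖₂) · vol_{n-1}(K ∩ a^⊥)`. -/
noncomputable def VK (n : ℕ) (K : Set (EuclideanSpace ℝ (Fin n)))
    (a : EuclideanSpace ℝ (Fin n)) : ℝ :=
  ((∑ i, |a i|) / ‖a‖) * sectVol n K a

/-- `K` is 1-symmetric: symmetric about every coordinate hyperplane and invariant
under permutations of the coordinates. -/
def IsOneSymmetric (n : ℕ) (K : Set (EuclideanSpace ℝ (Fin n))) : Prop :=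
  (∀ j : Fin n, ∀ x ∈ K,
      (WithLp.toLp 2 (fun i => if i = j then -(x i) else x i) : EuclideanSpace ℝ (Fin n)) ∈ K) ∧
  ∀ σ : Equiv.Perm (Fin n), ∀ x ∈ K,
      (WithLp.toLp 2 (fun i => x (σ i)) : EuclideanSpace ℝ (Fin n)) ∈ K

open scoped ENNReal

/-- Additive Brunn–Minkowski on the line, for compact sets. -/
theorem volume_add_volume_le_of_isCompact {A B H : Set ℝ} (hA : IsCompact A) (hB : IsCompact B)
    (hA0 : A.Nonempty) (hB0 : B.Nonempty) (hH : ∀ x ∈ A, ∀ y ∈ B, x + y ∈ H) :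
    volume A + volume B ≤ volume H := by
  obtain ⟨a, ha, hamax⟩ := hA.exists_isGreatest hA0
  obtain ⟨b, hb, hbmin⟩ := hB.exists_isLeast hB0
  have hA' : volume ((fun x => b + x) '' A) = volume A := by simp [Set.image_add_left]
  have hB' : volume ((fun x => a + x) '' B) = volume B := by simp [Set.image_add_left]
  have hdisj : AEDisjoint volume ((fun x => b + x) '' A) ((fun x => a + x) '' B) := by
    refine measure_mono_null (t := {a + b}) ?_ (by simp)
    rintro _ ⟨⟨x, hx, rfl⟩, y, hy, hxy⟩
    have h1 := hamax hx
    have h2 := hbmin hy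
    simp only [Set.mem_singleton_iff] at hxy ⊢
    linarith
  rw [← hA', ← hB', ← measure_union₀ (hB.image (by fun_prop)).measurableSet.nullMeasurableSet hdisj]
  refine measure_mono (Set.union_subset ?_ ?_)
  · rintro _ ⟨x, hx, rfl⟩
    simpa [add_comm] using hH x hx b hb
  · rintro _ ⟨y, hy, rfl⟩
    exact hH a ha y hy

/-- Brunn–Minkowski on the line, for measurable sets. -/
theorem volume_add_volume_le {A B H : Set ℝ} (hA : MeasurableSet A) (hB : MeasurableSet B)
    (hA0 : A.Nonempty) (hB0 : B.Nonempty) (hH : ∀ x ∈ A, ∀ y ∈ B, x + y ∈ H) :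
    volume A + volume B ≤ volume H := by
  obtain ⟨a, ha⟩ := hA0
  obtain ⟨b, hb⟩ := hB0
  rw [hA.measure_eq_iSup_isCompact, hB.measure_eq_iSup_isCompact]
  simp only [iSup_and']
  refine ENNReal.biSup_add_biSup_le' ⟨∅, by simp⟩ ⟨∅, by simp⟩ ?_
  intro S hS T hT
  calc volume S + volume T ≤ volume (insert a S) + volume (insert b T) := by
        gcongr <;> exact Set.subset_insert _ _
    _ ≤ volume H := volume_add_volume_le_of_isCompact (hS.2.insert a) (hT.2.insert b)
        (Set.insert_nonempty _ _) (Set.insert_nonempty _ _) fun x hx y hy =>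
          hH x (Set.insert_subset ha hS.1 hx) y (Set.insert_subset hb hT.1 hy)

theorem ofReal_mul_volume_add_le {p q : ℝ} (hp : 0 < p) (hq : 0 < q) {A B H : Set ℝ}
    (hA : MeasurableSet A) (hB : MeasurableSet B) (hA0 : A.Nonempty) (hB0 : B.Nonempty)
    (hH : ∀ x ∈ A, ∀ y ∈ B, p * x + q * y ∈ H) :
    ENNReal.ofReal p * volume A + ENNReal.ofReal q * volume B ≤ volume H := by
  have h := volume_add_volume_le (hA.const_smul_of_ne_zero hp.ne')
    (hB.const_smul_of_ne_zero hq.ne') (hA0.smul_set (a := p)) (hB0.smul_set (a := q)) (H := H) (by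
      rintro _ ⟨x, hx, rfl⟩ _ ⟨y, hy, rfl⟩
      exact hH x hx y hy)
  simpa [Measure.addHaar_smul, abs_of_pos hp, abs_of_pos hq] using h

/-- The Prékopa–Leindler inequality with weights `p`, `q` holds for the measure `μ`. -/
def PrekopaLeindler (p q : ℝ) {E : Type*} [AddCommGroup E] [Module ℝ E] [MeasurableSpace E]
    (μ : Measure E) : Prop :=
  ∀ f g h : E → ℝ≥0∞, Measurable f → Measurable g → Measurable h →
    (∀ x y, f x ^ p * g y ^ q ≤ h (p • x + q • y)) →
      (∫⁻ x, f x ∂μ) ^ p * (∫⁻ x, g x ∂μ) ^ q ≤ ∫⁻ x, h x ∂μ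

theorem PrekopaLeindler.prod {p q : ℝ} {E F : Type*} [AddCommGroup E] [Module ℝ E]
    [MeasurableSpace E] [AddCommGroup F] [Module ℝ F] [MeasurableSpace F]
    {μ : Measure E} {ν : Measure F} [SFinite μ] [SFinite ν]
    (hμ : PrekopaLeindler p q μ) (hν : PrekopaLeindler p q ν) :
    PrekopaLeindler p q (μ.prod ν) := by
  intro f g h hf hg hh H
  rw [lintegral_prod _ hf.aemeasurable, lintegral_prod _ hg.aemeasurable,
    lintegral_prod _ hh.aemeasurable]
  refine hμ _ _ _ hf.lintegral_prod_right' hg.lintegral_prod_right' hh.lintegral_prod_right' ?_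
  intro x x'
  exact hν _ _ _ (hf.comp measurable_prodMk_left) (hg.comp measurable_prodMk_left)
    (hh.comp measurable_prodMk_left) fun y y' => by simpa using H (x, y) (x', y')

theorem PrekopaLeindler.of_measurePreserving {p q : ℝ} {E F : Type*} [AddCommGroup E] [Module ℝ E]
    [MeasurableSpace E] [AddCommGroup F] [Module ℝ F] [MeasurableSpace F]
    {μ : Measure E} {ν : Measure F} (hμ : PrekopaLeindler p q μ) (L : E →ₗ[ℝ] F)
    (hL : MeasurePreserving L μ ν) : PrekopaLeindler p q ν := by
  intro f g h hf hg hh H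
  rw [← hL.lintegral_comp hf, ← hL.lintegral_comp hg, ← hL.lintegral_comp hh]
  refine hμ _ _ _ (hf.comp hL.measurable) (hg.comp hL.measurable) (hh.comp hL.measurable) ?_
  intro x y
  simpa using H (L x) (L y)

theorem lintegral_eq_lintegral_meas_lt_of_le_one {f : ℝ → ℝ≥0∞} (hf : Measurable f)
    (hf1 : ∀ x, f x ≤ 1) :
    ∫⁻ x, f x = ∫⁻ t in Set.Ioo (0 : ℝ) 1, volume {x | ENNReal.ofReal t < f x} := by
  have hfin : ∀ x, f x ≠ ∞ := fun x => ((hf1 x).trans_lt ENNReal.one_lt_top).ne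
  have h := lintegral_eq_lintegral_meas_lt (volume : Measure ℝ) (f := fun x => (f x).toReal)
    (by exact Filter.Eventually.of_forall fun x => ENNReal.toReal_nonneg)
    hf.ennreal_toReal.aemeasurable
  simp only [ENNReal.ofReal_toReal (hfin _)] at h
  rw [h, ← lintegral_indicator measurableSet_Ioi, ← lintegral_indicator measurableSet_Ioo]
  congr 1
  ext t
  by_cases h0 : 0 < t
  · by_cases h1 : t < 1
    · simp [h0, h1, ENNReal.ofReal_lt_iff_lt_toReal h0.le (hfin _)]
    · have : {a | t < (f a).toReal} = ∅ := by
        ext x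
        have := ENNReal.toReal_mono ENNReal.one_ne_top (hf1 x)
        simp at this ⊢
        linarith
      simp [h0, h1, this]
  · simp [h0]

theorem mul_lintegral_add_le_of_iSup_eq_one {p q : ℝ} (hp : 0 < p) (hq : 0 < q) (hpq : p + q = 1)
    {f g h : ℝ → ℝ≥0∞} (hf : Measurable f) (hg : Measurable g) (hh : Measurable h)
    (hf1 : ⨆ x, f x = 1) (hg1 : ⨆ x, g x = 1)
    (H : ∀ x y, f x ^ p * g y ^ q ≤ h (p * x + q * y)) :
    ENNReal.ofReal p * (∫⁻ x, f x) + ENNReal.ofReal q * (∫⁻ x, g x) ≤ ∫⁻ x, h x := by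
  have hfle : ∀ x, f x ≤ 1 := fun x => hf1 ▸ le_iSup f x
  have hgle : ∀ x, g x ≤ 1 := fun x => hg1 ▸ le_iSup g x
  refine le_trans ?_ (lintegral_mono fun x => min_le_left (h x) 1)
  rw [lintegral_eq_lintegral_meas_lt_of_le_one hf hfle,
    lintegral_eq_lintegral_meas_lt_of_le_one hg hgle,
    lintegral_eq_lintegral_meas_lt_of_le_one (hh.min measurable_const) fun x => min_le_right _ _]
  have hanti : ∀ u : ℝ → ℝ≥0∞, Measurable fun t : ℝ => volume {x | ENNReal.ofReal t < u x} :=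
    fun u => Antitone.measurable fun s t hst => measure_mono fun x hx =>
      (ENNReal.ofReal_le_ofReal hst).trans_lt hx
  rw [← lintegral_const_mul _ (hanti f), ← lintegral_const_mul _ (hanti g),
    ← lintegral_add_left ((hanti f).const_mul _)]
  refine setLIntegral_mono (hanti _) fun t ht => ?_
  have hlt : ENNReal.ofReal t < 1 := by simpa using ht.2
  have hne : ∀ u : ℝ → ℝ≥0∞, ⨆ x, u x = 1 → {x | ENNReal.ofReal t < u x}.Nonempty :=
    fun u hu => lt_iSup_iff.1 (hlt.trans_eq hu.symm)
  refine ofReal_mul_volume_add_le hp hq (measurableSet_lt measurable_const hf)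
    (measurableSet_lt measurable_const hg) (hne f hf1) (hne g hg1) ?_
  intro x hx y hy
  refine lt_min ((?_ : _ < _).trans_le (H x y)) hlt
  calc ENNReal.ofReal t = ENNReal.ofReal t ^ p * ENNReal.ofReal t ^ q := by
        rw [← ENNReal.rpow_add_of_nonneg _ _ hp.le hq.le, hpq, ENNReal.rpow_one]
    _ < _ := ENNReal.mul_lt_mul (ENNReal.rpow_lt_rpow hx hp) (ENNReal.rpow_lt_rpow hy hq)

theorem rpow_mul_rpow_le_add {p q : ℝ} (hp : 0 < p) (hq : 0 < q) (hpq : p + q = 1)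
    (x y : ℝ≥0∞) : x ^ p * y ^ q ≤ ENNReal.ofReal p * x + ENNReal.ofReal q * y := by
  by_cases hx : x = ∞
  · simp [hx, hp]
  by_cases hy : y = ∞
  · simp [hy, hq]
  lift x to NNReal using hx
  lift y to NNReal using hy
  have := NNReal.geom_mean_le_arith_mean2_weighted p.toNNReal q.toNNReal x y
    (by rw [← Real.toNNReal_add hp.le hq.le, hpq, Real.toNNReal_one])
  rw [Real.coe_toNNReal _ hp.le, Real.coe_toNNReal _ hq.le] at this
  rw [← ENNReal.coe_rpow_of_nonneg _ hp.le, ← ENNReal.coe_rpow_of_nonneg _ hq.le]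
  unfold ENNReal.ofReal
  exact_mod_cast this

theorem prekopaLeindler_real_of_bounded {p q : ℝ} (hp : 0 < p) (hq : 0 < q) (hpq : p + q = 1)
    {f g h : ℝ → ℝ≥0∞} (hf : Measurable f) (hg : Measurable g) (hh : Measurable h)
    (hf1 : ⨆ x, f x ≠ ∞) (hg1 : ⨆ x, g x ≠ ∞)
    (H : ∀ x y, f x ^ p * g y ^ q ≤ h (p * x + q * y)) :
    (∫⁻ x, f x) ^ p * (∫⁻ x, g x) ^ q ≤ ∫⁻ x, h x := by
  set M := ⨆ x, f x with hM
  set N := ⨆ x, g x with hN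
  by_cases hM0 : M = 0
  · have : f = 0 := by ext x; simpa using (le_iSup f x).trans_eq hM0
    simp [this, hp]
  by_cases hN0 : N = 0
  · have : g = 0 := by ext x; simpa using (le_iSup g x).trans_eq hN0
    simp [this, hq]
  have key := mul_lintegral_add_le_of_iSup_eq_one hp hq hpq (hf.const_mul M⁻¹)
    (hg.const_mul N⁻¹) (hh.const_mul (M⁻¹ ^ p * N⁻¹ ^ q))
    (by rw [← ENNReal.mul_iSup, ENNReal.inv_mul_cancel hM0 hf1])
    (by rw [← ENNReal.mul_iSup, ENNReal.inv_mul_cancel hN0 hg1])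
    (fun x y => by
      rw [ENNReal.mul_rpow_of_nonneg _ _ hp.le, ENNReal.mul_rpow_of_nonneg _ _ hq.le,
        mul_mul_mul_comm]
      gcongr
      exact H x y)
  have key' := (rpow_mul_rpow_le_add hp hq hpq _ _).trans key
  rw [lintegral_const_mul _ hf, lintegral_const_mul _ hg, lintegral_const_mul _ hh,
    ENNReal.mul_rpow_of_nonneg _ _ hp.le, ENNReal.mul_rpow_of_nonneg _ _ hq.le,
    mul_mul_mul_comm] at key'
  have h0 : M⁻¹ ^ p * N⁻¹ ^ q ≠ 0 := by
    simp [hp, hq, hf1, hg1, hp.not_gt, hq.not_gt]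
  have htop : M⁻¹ ^ p * N⁻¹ ^ q ≠ ∞ := ENNReal.mul_ne_top
    (ENNReal.rpow_ne_top_of_nonneg hp.le (by simpa)) (ENNReal.rpow_ne_top_of_nonneg hq.le (by simpa))
  exact (ENNReal.mul_le_mul_iff_right h0 htop).1 key'

/-- The Prékopa–Leindler inequality on the line. -/
theorem prekopaLeindler_real {p q : ℝ} (hp : 0 < p) (hq : 0 < q) (hpq : p + q = 1) :
    PrekopaLeindler p q (volume : Measure ℝ) := by
  intro f g h hf hg hh H
  have trunc : ∀ u : ℝ → ℝ≥0∞, Measurable u →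
      Filter.Tendsto (fun k : ℕ => ∫⁻ x, min (u x) k) Filter.atTop (nhds (∫⁻ x, u x)) := by
    intro u hu
    refine lintegral_tendsto_of_tendsto_of_monotone
      (fun k => (hu.min measurable_const).aemeasurable)
      (Filter.Eventually.of_forall fun x i j hij => min_le_min_left _ (by exact_mod_cast hij))
      (Filter.Eventually.of_forall fun x => ?_)
    simpa using tendsto_const_nhds.min ENNReal.tendsto_nat_nhds_top
  by_cases hf0 : ∫⁻ x, f x = 0
  · simp [hf0, hp]
  by_cases hg0 : ∫⁻ x, g x = 0
  · simp [hg0, hq]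
  refine le_of_tendsto' (ENNReal.Tendsto.mul
    ((ENNReal.continuous_rpow_const (y := p)).tendsto _ |>.comp (trunc f hf))
    (Or.inl ?_) ((ENNReal.continuous_rpow_const (y := q)).tendsto _ |>.comp (trunc g hg))
    (Or.inl ?_)) fun k => ?_
  · simp [hf0, hp.not_gt]
  · simp [hg0, hq.not_gt]
  · have hb : ∀ u : ℝ → ℝ≥0∞, ⨆ x, min (u x) (k : ℝ≥0∞) ≠ ∞ := fun u =>
      ((iSup_le fun x => min_le_right _ _).trans_lt (ENNReal.natCast_lt_top k)).ne
    refine prekopaLeindler_real_of_bounded hp hq hpq (hf.min measurable_const)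
      (hg.min measurable_const) hh (hb f) (hb g) fun x y => le_trans ?_ (H x y)
    gcongr <;> exact min_le_left _ _

theorem measurePreserving_cons (m : ℕ) :
    MeasurePreserving (fun z : ℝ × (Fin m → ℝ) => (Fin.cons z.1 z.2 : Fin (m + 1) → ℝ))
      (volume.prod volume) volume := by
  have h := (volume_preserving_piFinSuccAbove (fun _ : Fin (m + 1) => ℝ) 0).symm
  have e : ⇑(MeasurableEquiv.piFinSuccAbove (fun _ : Fin (m + 1) => ℝ) 0).symm =
      fun z : ℝ × (Fin m → ℝ) => (Fin.cons z.1 z.2 : Fin (m + 1) → ℝ) := by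
    ext z i
    simp [MeasurableEquiv.piFinSuccAbove]
  rw [e] at h
  exact h

/-- The Prékopa–Leindler inequality on `ℝ^m`. -/
theorem prekopaLeindler_pi {p q : ℝ} (hp : 0 < p) (hq : 0 < q) (hpq : p + q = 1) (m : ℕ) :
    PrekopaLeindler p q (volume : Measure (Fin m → ℝ)) := by
  induction m with
  | zero =>
    intro f g h hf hg hh H
    have := H 0 0
    simp only [smul_zero, add_zero] at this
    simpa only [volume_pi, Measure.pi_of_empty (fun _ => (volume : Measure ℝ)) 0,
      lintegral_dirac' _ hf, lintegral_dirac' _ hg, lintegral_dirac' _ hh] using this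
  | succ m ih =>
    refine ((prekopaLeindler_real hp hq hpq).prod ih).of_measurePreserving
      (Fin.consLinearEquiv ℝ (fun _ : Fin (m + 1) => ℝ)).toLinearMap ?_
    exact measurePreserving_cons m

/-- Brunn–Minkowski for sets of equal volume. -/
theorem volume_le_of_volume_eq {p q : ℝ} (hp : 0 < p) (hq : 0 < q) (hpq : p + q = 1) {m : ℕ}
    {A B H : Set (Fin m → ℝ)} (hA : MeasurableSet A) (hB : MeasurableSet B) (hH : MeasurableSet H)
    (hAB : volume B = volume A) (h : ∀ x ∈ A, ∀ y ∈ B, p • x + q • y ∈ H) :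
    volume A ≤ volume H := by
  have := prekopaLeindler_pi hp hq hpq m (A.indicator 1) (B.indicator 1) (H.indicator 1)
    (measurable_one.indicator hA) (measurable_one.indicator hB) (measurable_one.indicator hH) (by
      intro x y
      by_cases hx : x ∈ A
      · by_cases hy : y ∈ B
        · simp [hx, hy, h x hx y hy]
        · simp [hy, hq]
      · simp [hx, hp])
  rwa [lintegral_indicator_one hA, lintegral_indicator_one hB, lintegral_indicator_one hH, hAB,
    ← ENNReal.rpow_add_of_nonneg _ _ hp.le hq.le, hpq, ENNReal.rpow_one] at this

theorem hausdorffMeasure_euclideanSpace_eq_mul_volume (m : ℕ) :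
    ∃ C : ℝ≥0∞, ∀ S : Set (EuclideanSpace ℝ (Fin m)), MeasurableSet S →
      Measure.hausdorffMeasure (m : ℝ) S = C * volume (WithLp.toLp 2 ⁻¹' S) := by
  have hfr : ((Module.finrank ℝ (EuclideanSpace ℝ (Fin m)) : ℕ) : ℝ) = m := by simp
  have hH : (Measure.hausdorffMeasure (m : ℝ) :
      Measure (EuclideanSpace ℝ (Fin m))).IsAddHaarMeasure := by
    rw [← hfr]
    infer_instance
  refine ⟨Measure.addHaarScalarFactor (Measure.hausdorffMeasure (m : ℝ))
    (volume : Measure (EuclideanSpace ℝ (Fin m))), fun S hS => ?_⟩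
  have h := congrArg (fun ν : Measure (EuclideanSpace ℝ (Fin m)) => ν S)
    (Measure.isAddLeftInvariant_eq_smul (Measure.hausdorffMeasure (m : ℝ))
      (volume : Measure (EuclideanSpace ℝ (Fin m))))
  rw [(PiLp.volume_preserving_toLp (Fin m)).measure_preimage hS.nullMeasurableSet]
  exact h

/-- A linear hyperplane section of `K` has the measure of its coordinate preimage, up to a
dimensional constant. -/
theorem hausdorffMeasure_section_eq_volume (m : ℕ) :
    ∃ C : ℝ≥0∞, ∀ (V : Type) [NormedAddCommGroup V] [InnerProductSpace ℝ V]
      [FiniteDimensional ℝ V] [MeasurableSpace V] [BorelSpace V]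
      (_ : Module.finrank ℝ V = m + 1) (K : Set V) (_ : MeasurableSet K)
      (v : Fin m → V) (_ : Orthonormal ℝ v) (d : V) (_ : d ≠ 0)
      (_ : ∀ i, inner ℝ (v i) d = 0),
      Measure.hausdorffMeasure (m : ℝ) (K ∩ {x | inner ℝ x d = 0}) =
        C * volume {x : Fin m → ℝ | ∑ i, x i • v i ∈ K} := by
  obtain ⟨C, hC⟩ := hausdorffMeasure_euclideanSpace_eq_mul_volume m
  refine ⟨C, fun V _ _ _ _ _ hV K hK v hv d hd hvd => ?_⟩
  let D : Submodule ℝ V := (Submodule.span ℝ {d})ᗮ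
  have hmem : ∀ x : V, x ∈ D ↔ inner ℝ x d = 0 := fun x =>
    Submodule.mem_orthogonal_singleton_iff_inner_left
  have : Fact (Module.finrank ℝ V = m + 1) := ⟨hV⟩
  have hD : Fintype.card (Fin m) = Module.finrank ℝ D := by
    rw [Fintype.card_fin]
    exact (Submodule.finrank_orthogonal_span_singleton hd).symm
  let v' : Fin m → D := fun i => ⟨v i, (hmem _).2 (hvd i)⟩
  have hv' : Orthonormal ℝ v' :=
    ⟨fun i => hv.1 i, fun i j hij => hv.2 hij⟩
  let b : OrthonormalBasis (Fin m) ℝ D :=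
    OrthonormalBasis.mk hv' (by
      rw [hv'.linearIndependent.span_eq_top_of_card_eq_finrank' hD])
  let G : EuclideanSpace ℝ (Fin m) → V := fun x => (b.repr.symm x : D)
  have hG : Isometry G := D.subtypeₗᵢ.isometry.comp b.repr.symm.isometry
  have himg : K ∩ {x | inner ℝ x d = 0} = G '' (G ⁻¹' K) := by
    ext x
    constructor
    · rintro ⟨hx, hxd⟩
      have hGx : G (b.repr ⟨x, (hmem x).2 hxd⟩) = x := by simp [G]
      exact ⟨_, by rwa [Set.mem_preimage, hGx], hGx⟩
    · rintro ⟨y, hy, rfl⟩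
      exact ⟨hy, (hmem _).1 (b.repr.symm y).2⟩
  rw [himg, hG.hausdorffMeasure_image (Or.inl m.cast_nonneg), hC _ (hG.continuous.measurable hK)]
  congr 2
  ext x
  simp [G, b, v', ← b.sum_repr_symm]

theorem lintegral_eq_mul_lintegral_comp_mul_left {f : ℝ → ℝ≥0∞} (hf : Measurable f) {r : ℝ}
    (hr : 0 < r) :
    ∫⁻ s, f s = ENNReal.ofReal r * ∫⁻ s, f (r * s) := by
  conv_lhs => rw [← Real.smul_map_volume_mul_left hr.ne']
  rw [lintegral_smul_measure, lintegral_map hf (by fun_prop), abs_of_pos hr, smul_eq_mul]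

theorem measurableSet_slice {V : Type} [NormedAddCommGroup V] [InnerProductSpace ℝ V]
    [MeasurableSpace V] [BorelSpace V] {K : Set V} (hK : IsClosed K) {m : ℕ} (e : Fin m → V)
    (w : V) : MeasurableSet {z : ℝ × (Fin m → ℝ) | z.1 • w + ∑ i, z.2 i • e i ∈ K} :=
  (hK.preimage (by fun_prop : Continuous
    fun z : ℝ × (Fin m → ℝ) => z.1 • w + ∑ i, z.2 i • e i)).measurableSet

/-- Fubini for a hyperplane section of `K`, with slices orthogonal to a direction `w`. -/
theorem hausdorffMeasure_section_eq_lintegral (m : ℕ) :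
    ∃ C : ℝ≥0∞, ∀ (V : Type) [NormedAddCommGroup V] [InnerProductSpace ℝ V]
      [FiniteDimensional ℝ V] [MeasurableSpace V] [BorelSpace V]
      (_ : Module.finrank ℝ V = m + 2) (K : Set V) (_ : IsClosed K)
      (e : Fin m → V) (_ : Orthonormal ℝ e) (d w : V) (_ : d ≠ 0) (_ : w ≠ 0)
      (_ : ∀ i, inner ℝ (e i) d = 0) (_ : ∀ i, inner ℝ (e i) w = 0) (_ : inner ℝ w d = 0),
      Measure.hausdorffMeasure ((m + 1 : ℕ) : ℝ) (K ∩ {x | inner ℝ x d = 0}) =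
        C * (ENNReal.ofReal ‖w‖ *
          ∫⁻ s : ℝ, volume {x : Fin m → ℝ | s • w + ∑ i, x i • e i ∈ K}) := by
  obtain ⟨C, hC⟩ := hausdorffMeasure_section_eq_volume (m + 1)
  refine ⟨C, fun V _ _ _ _ _ hV K hK e he d w hd hw hed hew hwd => ?_⟩
  have hw0 : 0 < ‖w‖ := norm_pos_iff.2 hw
  have hv : Orthonormal ℝ (Fin.cons (‖w‖⁻¹ • w) e : Fin (m + 1) → V) := by
    refine ⟨fun i => ?_, fun i j hij => ?_⟩
    · refine Fin.cases ?_ (fun i => ?_) i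
      · simp [norm_smul, hw0.ne']
      · simpa using he.1 i
    · induction i using Fin.cases with
      | zero =>
        induction j using Fin.cases with
        | zero => exact absurd rfl hij
        | succ j => simp [inner_smul_left, real_inner_comm (e j) w, hew j]
      | succ i =>
        induction j using Fin.cases with
        | zero => simp [inner_smul_right, hew i]
        | succ j => simpa using he.2 (fun h => hij (by rw [h]))
  rw [hC V hV K hK.measurableSet _ hv d hd (by
    intro i
    refine Fin.cases ?_ (fun i => ?_) i
    · simp [inner_smul_left, hwd]
    · simpa using hed i)]
  congr 1
  have hmeas := measurableSet_slice hK e (‖w‖⁻¹ • w)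
  rw [← (measurePreserving_cons m).measure_preimage
    (by
      refine (hK.preimage (?_ : Continuous fun x : Fin (m + 1) → ℝ =>
        ∑ i, x i • (Fin.cons (‖w‖⁻¹ • w) e : Fin (m + 1) → V) i)).measurableSet.nullMeasurableSet
      fun_prop)]
  have hset : (fun z : ℝ × (Fin m → ℝ) => (Fin.cons z.1 z.2 : Fin (m + 1) → ℝ)) ⁻¹'
      {x | ∑ i, x i • (Fin.cons (‖w‖⁻¹ • w) e : Fin (m + 1) → V) i ∈ K} =
      {z | z.1 • (‖w‖⁻¹ • w) + ∑ i, z.2 i • e i ∈ K} := by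
    ext z
    simp [Fin.sum_univ_succ]
  rw [hset, Measure.prod_apply hmeas,
    lintegral_eq_mul_lintegral_comp_mul_left (measurable_measure_prodMk_left hmeas) hw0]
  refine congrArg _ (lintegral_congr fun s => congrArg _ ?_)
  ext x
  simp [smul_smul, mul_comm, hw0.ne']

/-- Sliding a hyperplane through the plane spanned by `c` and `u` towards the mirror `u^⊥` of `K`
does not decrease the section volume divided by the length of the normal vector. -/
theorem hausdorffMeasure_section_mul_le {m : ℕ} {V : Type} [NormedAddCommGroup V]
    [InnerProductSpace ℝ V] [FiniteDimensional ℝ V] [MeasurableSpace V] [BorelSpace V]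
    (hV : Module.finrank ℝ V = m + 2) {K : Set V} (hK : IsClosed K) (hconv : Convex ℝ K)
    (hneg : ∀ x ∈ K, -x ∈ K) {c u : V} (hc : c ≠ 0) (hu : u ≠ 0) (hcu : inner ℝ c u = 0)
    (hrefl : ∀ (x : V) (t : ℝ), inner ℝ x u = 0 → x + t • u ∈ K → x - t • u ∈ K)
    {p q : ℝ} (hp : 0 < p) (hq : 0 < q) (hpq : p + q = 1) (α : ℝ) :
    ENNReal.ofReal ‖c + ((p - q) * α) • u‖ *
        Measure.hausdorffMeasure ((m + 1 : ℕ) : ℝ) (K ∩ {x | inner ℝ x (c + α • u) = 0}) ≤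
      ENNReal.ofReal ‖c + α • u‖ * Measure.hausdorffMeasure ((m + 1 : ℕ) : ℝ)
        (K ∩ {x | inner ℝ x (c + ((p - q) * α) • u) = 0}) := by
  obtain ⟨C, hC⟩ := hausdorffMeasure_section_eq_lintegral m
  have huc : inner ℝ u c = 0 := by rw [real_inner_comm, hcu]
  have hc0 : 0 < ‖c‖ := norm_pos_iff.2 hc
  have hu0 : 0 < ‖u‖ := norm_pos_iff.2 hu
  obtain ⟨e, he, hec, heu⟩ : ∃ e : Fin m → V, Orthonormal ℝ e ∧ (∀ i, inner ℝ (e i) c = 0) ∧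
      ∀ i, inner ℝ (e i) u = 0 := by
    let P : Submodule ℝ V := Submodule.span ℝ {c, u}
    have hP : Module.finrank ℝ P ≤ 2 := by
      classical
      have := finrank_span_finset_le_card (R := ℝ) ({c, u} : Finset V)
      rw [coe_pair] at this
      exact this.trans card_le_two
    have hm : m ≤ Module.finrank ℝ Pᗮ := by
      have := P.finrank_add_finrank_orthogonal
      omega
    let b := stdOrthonormalBasis ℝ Pᗮ
    have hb : ∀ i, ∀ x ∈ P, inner ℝ (b i : V) x = 0 := fun i x hx =>
      Submodule.inner_left_of_mem_orthogonal hx (b i).2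
    refine ⟨fun i => b (Fin.castLE hm i), ?_, fun i => hb _ _ (Submodule.subset_span (by simp)),
      fun i => hb _ _ (Submodule.subset_span (by simp))⟩
    exact (b.orthonormal.comp_linearIsometry Pᗮ.subtypeₗᵢ).comp _ (Fin.castLE_injective hm)
  let w : ℝ → V := fun t => -(t * ‖u‖ ^ 2) • c + ‖c‖ ^ 2 • u
  have hd_sq : ∀ t, ‖c + t • u‖ ^ 2 = ‖c‖ ^ 2 + t ^ 2 * ‖u‖ ^ 2 := fun t => by
    rw [norm_add_sq_real, inner_smul_right, hcu, norm_smul, mul_pow, Real.norm_eq_abs, sq_abs]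
    ring
  have hd0 : ∀ t, c + t • u ≠ 0 := fun t h => by
    have := hd_sq t
    rw [h, norm_zero] at this
    nlinarith [sq_nonneg (t * ‖u‖), pow_pos hc0 2]
  have hw_norm : ∀ t, ‖w t‖ = ‖c‖ * ‖u‖ * ‖c + t • u‖ := fun t => by
    rw [← sq_eq_sq₀ (norm_nonneg _) (by positivity), mul_pow, hd_sq, norm_add_sq_real,
      inner_smul_right, inner_smul_left, hcu, norm_smul, norm_smul]
    simp only [mul_pow, Real.norm_eq_abs, sq_abs]
    ring
  have hw0 : ∀ t, w t ≠ 0 := fun t => by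
    rw [← norm_pos_iff, hw_norm]
    have := norm_pos_iff.2 (hd0 t)
    positivity
  have hsec : ∀ t, Measure.hausdorffMeasure ((m + 1 : ℕ) : ℝ)
      (K ∩ {x | inner ℝ x (c + t • u) = 0}) = C * (ENNReal.ofReal (‖c‖ * ‖u‖) *
        ENNReal.ofReal ‖c + t • u‖ *
          ∫⁻ s : ℝ, volume {x : Fin m → ℝ | s • w t + ∑ i, x i • e i ∈ K}) := fun t => by
    rw [hC V hV K hK e he _ (w t) (hd0 t) (hw0 t), hw_norm, ENNReal.ofReal_mul (by positivity)]
    · intro i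
      simp [inner_add_right, inner_smul_right, hec, heu]
    · intro i
      simp [w, inner_add_right, inner_smul_right, hec, heu]
    · simp only [w, inner_add_right, inner_add_left, inner_smul_left, inner_smul_right, hcu, huc,
        real_inner_self_eq_norm_sq, conj_trivial]
      ring
  have hrefl_w : ∀ (s t : ℝ) (x : Fin m → ℝ), s • w t + ∑ i, x i • e i ∈ K →
      s • w (-t) + ∑ i, (-x) i • e i ∈ K := fun s t x hx => by
    have h1 := hrefl (-(s * (t * ‖u‖ ^ 2)) • c + ∑ i, x i • e i) (s * ‖c‖ ^ 2)
      (by simp [inner_add_left, inner_smul_left, sum_inner, hcu, heu])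
      (by convert hx using 1; simp only [w]; module)
    convert hneg _ h1 using 1
    simp only [w, Pi.neg_apply, neg_smul, sum_neg_distrib]
    module
  have hslice : ∀ s t, MeasurableSet {x : Fin m → ℝ | s • w t + ∑ i, x i • e i ∈ K} :=
    fun s t => (measurableSet_slice hK e (w t)).preimage measurable_prodMk_left
  have hle : ∀ s : ℝ, volume {x : Fin m → ℝ | s • w α + ∑ i, x i • e i ∈ K} ≤
      volume {x : Fin m → ℝ | s • w ((p - q) * α) + ∑ i, x i • e i ∈ K} := fun s => by
    refine volume_le_of_volume_eq hp hq hpq (hslice s α) (hslice s (-α)) (hslice s _) ?_ ?_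
    · rw [← Measure.measure_neg]
      congr 1
      ext x
      constructor
      · intro h
        simpa using hrefl_w s (-α) (-x) h
      · intro h
        exact hrefl_w s α x h
    · intro x hx y hy
      rw [Set.mem_ofPred_eq]
      convert hconv hx hy hp.le hq.le hpq using 1
      simp only [w, Pi.add_apply, Pi.smul_apply, smul_eq_mul, add_smul, sum_add_distrib, mul_smul,
        ← smul_sum]
      obtain rfl : q = 1 - p := by linarith
      module
  rw [hsec, hsec]
  calc _ = C * ENNReal.ofReal (‖c‖ * ‖u‖) * ENNReal.ofReal ‖c + α • u‖ *
        ENNReal.ofReal ‖c + ((p - q) * α) • u‖ *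
          ∫⁻ s : ℝ, volume {x : Fin m → ℝ | s • w α + ∑ i, x i • e i ∈ K} := by ring
    _ ≤ C * ENNReal.ofReal (‖c‖ * ‖u‖) * ENNReal.ofReal ‖c + α • u‖ *
        ENNReal.ofReal ‖c + ((p - q) * α) • u‖ *
          ∫⁻ s : ℝ, volume {x : Fin m → ℝ | s • w ((p - q) * α) + ∑ i, x i • e i ∈ K} := by
      exact mul_le_mul_right (lintegral_mono hle) _
    _ = _ := by ring

theorem hausdorffMeasure_section_ne_top {m : ℕ} {V : Type} [NormedAddCommGroup V]
    [InnerProductSpace ℝ V] [FiniteDimensional ℝ V] [MeasurableSpace V] [BorelSpace V]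
    (hV : Module.finrank ℝ V = m + 1) {K : Set V} (hK : IsCompact K) {d : V} (hd : d ≠ 0) :
    Measure.hausdorffMeasure (m : ℝ) (K ∩ {x | inner ℝ x d = 0}) ≠ ∞ := by
  let D : Submodule ℝ V := (Submodule.span ℝ {d})ᗮ
  have : Fact (Module.finrank ℝ V = m + 1) := ⟨hV⟩
  have hD : Module.finrank ℝ D = m := Submodule.finrank_orthogonal_span_singleton hd
  have himg : K ∩ {x | inner ℝ x d = 0} = (Subtype.val : D → V) '' (Subtype.val ⁻¹' K) := by
    ext x
    simp [D, Submodule.mem_orthogonal_singleton_iff_inner_left, and_comm]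
  rw [himg, isometry_subtype_coe.hausdorffMeasure_image (Or.inl m.cast_nonneg), ← hD]
  have hH : (Measure.hausdorffMeasure (Module.finrank ℝ D : ℝ) : Measure D).IsAddHaarMeasure :=
    isAddHaarMeasure_hausdorffMeasure
  exact (D.closed_of_finiteDimensional.isClosedEmbedding_subtypeVal.isCompact_preimage
    hK).measure_lt_top.ne

theorem IsOneSymmetric.flip_mem {n : ℕ} {K : Set (EuclideanSpace ℝ (Fin n))}
    (hK : IsOneSymmetric n K) (s : Finset (Fin n)) {x : EuclideanSpace ℝ (Fin n)} (hx : x ∈ K) :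
    (WithLp.toLp 2 fun i => if i ∈ s then -(x i) else x i : EuclideanSpace ℝ (Fin n)) ∈ K := by
  classical
  induction s using Finset.induction_on with
  | empty => simpa using hx
  | insert j s hj ih =>
    convert hK.1 j _ ih using 3 with i
    by_cases hij : i = j
    · subst hij
      simp [hj]
    · simp [hij]

theorem IsOneSymmetric.neg_mem {n : ℕ} {K : Set (EuclideanSpace ℝ (Fin n))}
    (hK : IsOneSymmetric n K) {x : EuclideanSpace ℝ (Fin n)} (hx : x ∈ K) : -x ∈ K := by
  convert hK.flip_mem univ hx using 1
  ext i
  simp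

theorem IsOneSymmetric.swap_mem {n : ℕ} {K : Set (EuclideanSpace ℝ (Fin n))}
    (hK : IsOneSymmetric n K) {i j : Fin n} (hij : i ≠ j) {u x : EuclideanSpace ℝ (Fin n)}
    (hu : u = EuclideanSpace.single i 1 - EuclideanSpace.single j 1) {t : ℝ}
    (hxu : inner ℝ x u = 0) (hx : x + t • u ∈ K) : x - t • u ∈ K := by
  subst hu
  have hxij : x i = x j := by
    simp only [inner_sub_right, EuclideanSpace.inner_single_right] at hxu
    simpa [sub_eq_zero] using hxu
  convert hK.2 (Equiv.swap i j) _ hx using 1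
  ext k
  by_cases hki : k = i
  · subst hki
    simp [hij, hij.symm, hxij, sub_eq_add_neg]
  by_cases hkj : k = j
  · subst hkj
    simp [hij, hij.symm, hxij]
  · simp [Equiv.swap_apply_of_ne_of_ne hki hkj, hki, hkj]

theorem sectVol_smul (n : ℕ) (K : Set (EuclideanSpace ℝ (Fin n))) (a : EuclideanSpace ℝ (Fin n))
    {r : ℝ} (hr : r ≠ 0) : sectVol n K (r • a) = sectVol n K a := by
  simp [sectVol, inner_smul_right, hr]

theorem sectVol_le_sectVol_abs {n : ℕ} (hn : 1 ≤ n) {K : Set (EuclideanSpace ℝ (Fin n))}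
    (hcpt : IsCompact K) (hK : IsOneSymmetric n K) {a : EuclideanSpace ℝ (Fin n)} (ha : a ≠ 0) :
    sectVol n K a ≤ sectVol n K (WithLp.toLp 2 fun i => |a i|) := by
  obtain ⟨m, rfl⟩ : ∃ m, n = m + 1 := ⟨n - 1, by omega⟩
  have hcast : ((m + 1 : ℕ) : ℝ) - 1 = m := by push_cast; ring
  unfold sectVol
  rw [hcast]
  have hb : (WithLp.toLp 2 fun i => |a i| : EuclideanSpace ℝ (Fin (m + 1))) ≠ 0 := fun h =>
    ha (by ext i; simpa using congrArg (fun v : EuclideanSpace ℝ (Fin (m + 1)) => v i) h)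
  refine ENNReal.toReal_mono (hausdorffMeasure_section_ne_top (by simp) hcpt hb) ?_
  classical
  let F : EuclideanSpace ℝ (Fin (m + 1)) → EuclideanSpace ℝ (Fin (m + 1)) := fun x =>
    WithLp.toLp 2 fun i => if i ∈ univ.filter (fun i => a i < 0) then -(x i) else x i
  have hF : Isometry F := by
    refine Isometry.of_dist_eq fun x y => ?_
    rw [EuclideanSpace.dist_eq, EuclideanSpace.dist_eq]
    congr 1
    refine sum_congr rfl fun i _ => ?_
    by_cases h : a i < 0 <;> simp [F, h, dist_neg_neg]
  rw [← hF.hausdorffMeasure_image (Or.inl m.cast_nonneg)]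
  refine measure_mono ?_
  rintro _ ⟨x, ⟨hx, hxa⟩, rfl⟩
  refine ⟨hK.flip_mem _ hx, ?_⟩
  rw [Set.mem_ofPred_eq] at hxa ⊢
  rw [← hxa]
  simp only [PiLp.inner_apply]
  refine sum_congr rfl fun i _ => ?_
  by_cases h : a i < 0
  · simp [F, h, abs_of_neg h]
  · simp [F, h, abs_of_nonneg (not_lt.1 h)]

/-- Moving two unequal coordinates of the normal vector towards each other does not decrease the
section volume divided by the length of the normal vector. -/
theorem norm_mul_sectVol_le {n : ℕ} {K : Set (EuclideanSpace ℝ (Fin n))} (hcpt : IsCompact K)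
    (hconv : Convex ℝ K) (hK : IsOneSymmetric n K) {i j : Fin n} (hij : i ≠ j)
    {c : EuclideanSpace ℝ (Fin n)} (hc : c ≠ 0) (hcij : c i = c j) {α β : ℝ} (hβ : |β| < α)
    {u : EuclideanSpace ℝ (Fin n)}
    (hu : u = EuclideanSpace.single i 1 - EuclideanSpace.single j 1) :
    ‖c + β • u‖ * sectVol n K (c + α • u) ≤ ‖c + α • u‖ * sectVol n K (c + β • u) := by
  obtain ⟨m, rfl⟩ : ∃ m, n = m + 2 := by
    have := i.2
    have := j.2
    have : (i : ℕ) ≠ j := fun h => hij (Fin.ext h)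
    exact ⟨n - 2, by omega⟩
  have hcast : ((m + 2 : ℕ) : ℝ) - 1 = ((m + 1 : ℕ) : ℝ) := by push_cast; ring
  have hα : 0 < α := (abs_nonneg β).trans_lt hβ
  have hcu : inner ℝ c u = 0 := by
    simp [hu, inner_sub_right, EuclideanSpace.inner_single_right, hcij]
  have hu0 : u ≠ 0 := fun h => by
    have := congrArg (fun v : EuclideanSpace ℝ (Fin (m + 2)) => v i) h
    simp [hu, hij] at this
  have hβ0 : c + β • u ≠ 0 := fun h => by
    have : inner ℝ c (c + β • u) = 0 := by rw [h, inner_zero_right]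
    rw [inner_add_right, inner_smul_right, hcu, mul_zero, add_zero] at this
    exact hc (inner_self_eq_zero.1 this)
  have hβ' := abs_lt.1 hβ
  have key := hausdorffMeasure_section_mul_le (m := m) (by simp) hcpt.isClosed hconv
    (fun x hx => hK.neg_mem hx) hc hu0 hcu (fun x t h hx => hK.swap_mem hij hu h hx)
    (p := (1 + β / α) / 2) (q := (1 - β / α) / 2)
    (by
      have : -1 < β / α := by rw [lt_div_iff₀ hα]; linarith
      linarith)
    (by
      have : β / α < 1 := by rw [div_lt_one hα]; linarith
      linarith) (by ring) α
  have hβα : ((1 + β / α) / 2 - (1 - β / α) / 2) * α = β := by field_simp; ring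
  rw [hβα] at key
  unfold sectVol
  rw [hcast]
  have := ENNReal.toReal_mono (ENNReal.mul_ne_top ENNReal.ofReal_ne_top
    (hausdorffMeasure_section_ne_top (by simp) hcpt hβ0)) key
  simpa [ENNReal.toReal_mul] using this

/-- Among nonnegative normal vectors with prescribed coordinate sum, the diagonal one maximizes the
section volume divided by the length of the normal vector. -/
theorem norm_diagonal_mul_sectVol_le {n : ℕ} {K : Set (EuclideanSpace ℝ (Fin n))}
    (hcpt : IsCompact K) (hconv : Convex ℝ K) (hK : IsOneSymmetric n K) {μ : ℝ} (hμ : 0 < μ)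
    (a : EuclideanSpace ℝ (Fin n)) (ha : ∀ i, 0 ≤ a i) (hsum : ∑ i, a i = n * μ) :
    ‖(WithLp.toLp 2 fun _ => μ : EuclideanSpace ℝ (Fin n))‖ * sectVol n K a ≤
      ‖a‖ * sectVol n K (WithLp.toLp 2 fun _ => μ) := by
  induction hN : #{i | a i ≠ μ} using Nat.strong_induction_on generalizing a with
  | _ N ih =>
  by_cases hall : ∀ i, a i = μ
  · obtain rfl : a = WithLp.toLp 2 fun _ => μ := by ext i; exact hall i
    exact le_rfl
  have hsum' : ∑ i, a i = ∑ _i : Fin n, μ := by simp [hsum]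
  obtain ⟨k, hk⟩ := not_forall.1 hall
  obtain ⟨i, hi⟩ : ∃ i, μ < a i := by
    by_contra! h
    exact hk ((sum_eq_sum_iff_of_le fun i _ => h i).1 hsum' k (mem_univ k))
  obtain ⟨j, hj⟩ : ∃ j, a j < μ := by
    by_contra! h
    exact hk ((sum_eq_sum_iff_of_le fun i _ => h i).1 hsum'.symm k (mem_univ k)).symm
  have hij : i ≠ j := fun h => by rw [h] at hi; linarith
  let u : EuclideanSpace ℝ (Fin n) := EuclideanSpace.single i 1 - EuclideanSpace.single j 1
  have hui : u i = 1 := by simp [u, hij]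
  have huj : u j = -1 := by simp [u, hij.symm]
  have huk : ∀ k, k ≠ i → k ≠ j → u k = 0 := fun k hki hkj => by simp [u, hki, hkj]
  have husum : ∑ k, u k = 0 := by simp [u]
  set α := (a i - a j) / 2 with hα
  set β := μ - (a i + a j) / 2 with hβ
  let c : EuclideanSpace ℝ (Fin n) := a - α • u
  have hci : c i = (a i + a j) / 2 := by simp [c, hui, hα]; ring
  have hcj : c j = (a i + a j) / 2 := by simp [c, huj, hα]; ring
  have hc0 : c ≠ 0 := fun h => by
    have : c i = 0 := by rw [h]; rfl
    have := ha j
    linarith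
  have hstep := norm_mul_sectVol_le hcpt hconv hK hij hc0 (hci.trans hcj.symm) (α := α) (β := β)
    (abs_lt.2 ⟨by linarith, by linarith⟩) (u := u) rfl
  have hca : c + α • u = a := by simp [c]
  rw [hca] at hstep
  set b := c + β • u with hb
  have hbi : b i = μ := by simp [hb, hci, hui, hβ]
  have hbj : b j = a i + a j - μ := by simp [hb, hcj, huj, hβ]; ring
  have hbk : ∀ k, k ≠ i → k ≠ j → b k = a k := fun k hki hkj => by
    simp [hb, c, huk k hki hkj]
  have hb_nonneg : ∀ k, 0 ≤ b k := fun k => by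
    by_cases hki : k = i
    · rw [hki, hbi]; exact hμ.le
    by_cases hkj : k = j
    · rw [hkj, hbj]; linarith [ha j]
    · rw [hbk k hki hkj]; exact ha k
  have hb_sum : ∑ k, b k = n * μ := by
    simp [hb, c, sum_add_distrib, sum_sub_distrib, ← mul_sum, husum, hsum]
  have hcard : #{k | b k ≠ μ} < N := by
    rw [← hN]
    refine card_lt_card (ssubset_iff_of_subset ?_ |>.2 ⟨i, by simp [hi.ne'], by simp [hbi]⟩)
    intro k
    simp only [mem_filter, mem_univ, true_and]
    intro hbk' hak
    by_cases hki : k = i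
    · exact hbk' (hki ▸ hbi)
    by_cases hkj : k = j
    · rw [hkj] at hak; linarith
    · exact hbk' ((hbk k hki hkj).trans hak)
  have hrec := ih _ hcard b hb_nonneg hb_sum rfl
  have hb_pos : 0 < ‖b‖ := norm_pos_iff.2 fun h => by
    rw [h] at hbi
    exact hμ.ne hbi
  refine le_of_mul_le_mul_left ?_ hb_pos
  have h1 := mul_le_mul_of_nonneg_left hstep
    (norm_nonneg (WithLp.toLp 2 fun _ => μ : EuclideanSpace ℝ (Fin n)))
  have h2 := mul_le_mul_of_nonneg_left hrec (norm_nonneg a)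
  linarith

theorem sup_VK_attained_at_diagonal (n : ℕ) (hn : 1 ≤ n)
    (K : Set (EuclideanSpace ℝ (Fin n)))
    (hK_cpt : IsCompact K) (hK_conv : Convex ℝ K)
    (hK_int : (interior K).Nonempty) (hK_sym : IsOneSymmetric n K) :
    (∀ a : EuclideanSpace ℝ (Fin n), a ≠ 0 →
        VK n K a ≤ VK n K (WithLp.toLp 2 (fun _ => 1) : EuclideanSpace ℝ (Fin n))) ∧
      VK n K (WithLp.toLp 2 (fun _ => 1) : EuclideanSpace ℝ (Fin n)) =
        Real.sqrt n * sectVol n K (WithLp.toLp 2 (fun _ => 1) : EuclideanSpace ℝ (Fin n)) := by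
  have hn0 : (0 : ℝ) < n := by exact_mod_cast hn
  have hdiag : VK n K (WithLp.toLp 2 (fun _ => 1) : EuclideanSpace ℝ (Fin n)) =
      Real.sqrt n * sectVol n K (WithLp.toLp 2 (fun _ => 1) : EuclideanSpace ℝ (Fin n)) := by
    simp [VK, EuclideanSpace.norm_eq, Real.div_sqrt]
  refine ⟨fun a ha => ?_, hdiag⟩
  rw [hdiag]
  set b : EuclideanSpace ℝ (Fin n) := WithLp.toLp 2 fun i => |a i| with hb
  set S := sectVol n K (WithLp.toLp 2 (fun _ => 1) : EuclideanSpace ℝ (Fin n))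
  have hnorm : ‖b‖ = ‖a‖ := by simp [hb, EuclideanSpace.norm_eq]
  have ha0 : 0 < ‖a‖ := norm_pos_iff.2 ha
  have hsum_pos : 0 < ∑ i, |a i| := by
    obtain ⟨i, hi⟩ : ∃ i, a i ≠ 0 := by
      by_contra! h
      exact ha (by ext i; exact h i)
    exact sum_pos' (fun i _ => abs_nonneg _) ⟨i, mem_univ i, abs_pos.2 hi⟩
  set μ := (∑ i, |a i|) / n with hμ
  have hμ0 : 0 < μ := div_pos hsum_pos hn0
  have key := norm_diagonal_mul_sectVol_le hK_cpt hK_conv hK_sym hμ0 b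
    (fun i => abs_nonneg _) (by rw [hμ, mul_div_cancel₀ _ hn0.ne'])
  have hμ1 : (WithLp.toLp 2 fun _ => μ : EuclideanSpace ℝ (Fin n)) =
      μ • WithLp.toLp 2 fun _ => 1 := by
    ext i
    simp
  rw [hμ1, sectVol_smul n K _ hμ0.ne', norm_smul, hnorm] at key
  have hone : ‖(WithLp.toLp 2 fun _ => 1 : EuclideanSpace ℝ (Fin n))‖ = √n := by
    simp [EuclideanSpace.norm_eq]
  rw [hone, Real.norm_of_nonneg hμ0.le] at key
  have hsqrt : √(n : ℝ) * √n = n := Real.mul_self_sqrt hn0.le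
  have hsum : ∑ i, |a i| = √n * (μ * √n) := by
    rw [hμ, mul_left_comm, hsqrt, div_mul_cancel₀ _ hn0.ne']
  unfold VK
  rw [div_mul_eq_mul_div, div_le_iff₀ ha0]
  calc (∑ i, |a i|) * sectVol n K a
      ≤ (∑ i, |a i|) * sectVol n K b := by
        gcongr
        exact sectVol_le_sectVol_abs hn hK_cpt hK_sym ha
    _ = √n * (μ * √n * sectVol n K b) := by rw [hsum]; ring
    _ ≤ √n * (‖a‖ * S) := by gcongr
    _ = √n * S * ‖a‖ := by ring
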